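/- Let P be a convex polytope with ℓ nonconstant on edges satisfying the Stratification Assumption, and suppose the source v and sink w of P are connected by a directed edge v → w. Then the number of triangular 2-faces of P of the form (v, w, x) is at least dim P − 1. -/

import Mathlib

open Set

variable {V : Type*} [NormedAddCommGroup V] [NormedSpace ℝ V]

/-- A (nonempty) convex polytope: the convex hull of a nonempty finite set of points. -/
def IsPolytope (P : Set V) : Prop :=
  ∃ s : Finset V, s.Nonempty ∧ P = convexHull ℝ (s : Set V)

/-- A (nonempty exposed) face of a polytope. -/
def IsFace (P F : Set V) : Prop :=
  F.Nonempty ∧ IsExposed ℝ P F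

/-- A vertex of a polytope: a point whose singleton is a face. -/
def IsVertex (P : Set V) (v : V) : Prop := IsFace P {v}

/-- An edge of a polytope: a face which is a nondegenerate segment. -/
def IsEdge (P : Set V) (v w : V) : Prop := v ≠ w ∧ IsFace P (segment ℝ v w)

/-- `ℓ` attains its maximum on `G` at `v`. -/
def MaxAt (ℓ : V →L[ℝ] ℝ) (G : Set V) (v : V) : Prop := v ∈ G ∧ ∀ x ∈ G, ℓ x ≤ ℓ v

/-- `ℓ` attains its minimum on `G` at `v`. -/
def MinAt (ℓ : V →L[ℝ] ℝ) (G : Set V) (v : V) : Prop := v ∈ G ∧ ∀ x ∈ G, ℓ v ≤ ℓ x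

/-- `ℓ` is nonconstant on every edge of `P`. -/
def NonconstOnEdges (P : Set V) (ℓ : V →L[ℝ] ℝ) : Prop :=
  ∀ v w, IsEdge P v w → ℓ v ≠ ℓ w

/-- Directed edge: an edge oriented by increasing `ℓ`. -/
def DirEdge (P : Set V) (ℓ : V →L[ℝ] ℝ) (v w : V) : Prop := IsEdge P v w ∧ ℓ v < ℓ w

/-- The witness relation `O(v,w)`: some face of `P` has ℓ-minimum at `v` and
ℓ-maximum at `w`. -/
def ORel (P : Set V) (ℓ : V →L[ℝ] ℝ) (v w : V) : Prop :=
  ∃ G, IsFace P G ∧ MinAt ℓ G v ∧ MaxAt ℓ G w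

/-- `O⁻(v)`: the union of relative interiors of faces of `P` on which `ℓ` attains
its maximum at `v`. -/
def Oneg (P : Set V) (ℓ : V →L[ℝ] ℝ) (v : V) : Set V :=
  ⋃ G ∈ {G : Set V | IsFace P G ∧ MaxAt ℓ G v}, intrinsicInterior ℝ G

/-- `O⁺(v)`: the union of relative interiors of faces of `P` on which `ℓ` attains
its minimum at `v`. -/
def Opos (P : Set V) (ℓ : V →L[ℝ] ℝ) (v : V) : Set V :=
  ⋃ G ∈ {G : Set V | IsFace P G ∧ MinAt ℓ G v}, intrinsicInterior ℝ G

/-- `F⁻(v)`: the closure of `O⁻(v)`. -/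
def Fneg (P : Set V) (ℓ : V →L[ℝ] ℝ) (v : V) : Set V := closure (Oneg P ℓ v)

/-- `F⁺(v)`: the closure of `O⁺(v)`. -/
def Fpos (P : Set V) (ℓ : V →L[ℝ] ℝ) (v : V) : Set V := closure (Opos P ℓ v)

/-- The partition `O⁻` is a stratification. -/
def StratNeg (P : Set V) (ℓ : V →L[ℝ] ℝ) : Prop :=
  ∀ u w : V, IsVertex P u → IsVertex P w →
    (Oneg P ℓ u ∩ Fneg P ℓ w).Nonempty → Oneg P ℓ u ⊆ Fneg P ℓ w

/-- The dimension of a subset of `V` (dimension of its affine span). -/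
noncomputable def dimS (F : Set V) : ℕ := Module.finrank ℝ (vectorSpan ℝ F)

lemma conv_max (s K : Set V) (hK : Convex ℝ K) (f : V →L[ℝ] ℝ) (M : ℝ)
    (h : ∀ x ∈ s, f x ≤ M ∧ (f x = M → x ∈ K)) :
    ∀ y ∈ convexHull ℝ s, f y ≤ M ∧ (f y = M → y ∈ K) := by
  have hc : Convex ℝ {y : V | f y ≤ M ∧ (f y = M → y ∈ K)} := by
    intro x hx y hy a b ha hb hab
    simp only [mem_ofPred_eq] at hx hy ⊢
    simp only [map_add, map_smul, smul_eq_mul]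
    have hM : M = a * M + b * M := by rw [← add_mul, hab, one_mul]
    have h1 := mul_le_mul_of_nonneg_left hx.1 ha
    have h2 := mul_le_mul_of_nonneg_left hy.1 hb
    refine ⟨by linarith, fun he => ?_⟩
    rcases ha.eq_or_lt with rfl | ha'
    · have : b = 1 := by linarith
      subst this
      simp only [zero_smul, one_smul, zero_add]
      exact hy.2 (by linarith)
    rcases hb.eq_or_lt with rfl | hb'
    · have : a = 1 := by linarith
      subst this
      simp only [zero_smul, one_smul, add_zero]
      exact hx.2 (by linarith)
    have e1 : f x = M := by
      have : a * f x = a * M := by linarith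
      exact mul_left_cancel₀ ha'.ne' this
    have e2 : f y = M := by
      have : b * f y = b * M := by linarith
      exact mul_left_cancel₀ hb'.ne' this
    exact hK (hx.2 e1) (hy.2 e2) ha hb hab
  exact fun y hy => convexHull_min (fun x hx => h x hx) hc hy

lemma face_of_face (s : Finset V) (ψ χ : V →L[ℝ] ℝ) (M M' : ℝ) (A : Set V)
    (hA : A.Nonempty) (hAs : A ⊆ convexHull ℝ (s : Set V))
    (hA1 : ∀ x ∈ A, ψ x = M ∧ χ x = M')
    (h1 : ∀ x ∈ s, ψ x ≤ M)
    (h2 : ∀ x ∈ s, ψ x = M → χ x ≤ M' ∧ (χ x = M' → x ∈ convexHull ℝ A)) :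
    IsFace (convexHull ℝ (s : Set V)) (convexHull ℝ A) := by
  obtain ⟨N, hN⟩ : ∃ N : ℝ, ∀ x ∈ s, ψ x < M → χ x - M' < N * (M - ψ x) := by
    have : ∀ᶠ N : ℝ in Filter.atTop, ∀ x ∈ s, ψ x < M → χ x - M' < N * (M - ψ x) := by
      rw [Filter.eventually_all_finset]
      intro x _
      by_cases hx : ψ x < M
      · filter_upwards [Filter.eventually_gt_atTop ((χ x - M') / (M - ψ x))] with N hN _
        rwa [div_lt_iff₀ (by linarith)] at hN
      · exact Filter.Eventually.of_forall fun N h => absurd h hx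
    exact this.exists
  set f : V →L[ℝ] ℝ := N • ψ + χ with hf
  have hfx : ∀ x, f x = N * ψ x + χ x := fun x => by simp [hf]
  have key := conv_max (s : Set V) (convexHull ℝ A) (convex_convexHull ℝ A) f (N * M + M') (by
    intro x hx
    rw [hfx]
    rcases (h1 x hx).lt_or_eq with h | h
    · have := hN x hx h
      exact ⟨by linarith, fun he => by linarith⟩
    · have := h2 x hx h
      rw [h]
      exact ⟨by linarith, fun he => this.2 (by linarith)⟩)
  have hAm : ∀ y ∈ convexHull ℝ A, f y = N * M + M' := by
    have hc : Convex ℝ {y : V | f y = N * M + M'} :=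
      convex_hyperplane f.toLinearMap.isLinear _
    refine fun y hy => convexHull_min (fun x hx => ?_) hc hy
    simp only [mem_ofPred_eq]
    rw [hfx, (hA1 x hx).1, (hA1 x hx).2]
  have hAP : convexHull ℝ A ⊆ convexHull ℝ (s : Set V) :=
    convexHull_min hAs (convex_convexHull ℝ _)
  refine ⟨hA.convexHull, fun _ => ⟨f, ?_⟩⟩
  ext y
  constructor
  · intro hy
    exact ⟨hAP hy, fun z hz => by rw [hAm y hy]; exact (key z hz).1⟩
  · rintro ⟨hy, hm⟩
    obtain ⟨a, ha⟩ := hA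
    have := hm a (hAs ha)
    rw [hAm a (subset_convexHull ℝ A ha)] at this
    exact (key y hy).2 (le_antisymm (key y hy).1 this)

lemma mem_conv_pair (p q z : V) (θ : ℝ) (h0 : 0 ≤ θ) (h1 : θ ≤ 1)
    (h : z = p + θ • (q - p)) : z ∈ convexHull ℝ ({p, q} : Set V) := by
  rw [convexHull_pair]
  exact ⟨1 - θ, θ, by linarith, h0, by ring, by rw [h]; module⟩

lemma seg_aux {ℓ : V →L[ℝ] ℝ} {p q z : V} (hz : z ∈ segment ℝ p q) (h : ℓ p < ℓ q) :
    ℓ p ≤ ℓ z ∧ ℓ z ≤ ℓ q ∧ (ℓ z = ℓ q → z = q) := by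
  obtain ⟨a, b, ha, hb, hab, rfl⟩ := hz
  simp only [map_add, map_smul, smul_eq_mul]
  have : a = 1 - b := by linarith
  subst this
  refine ⟨by nlinarith, by nlinarith, fun he => ?_⟩
  have : (1 - b) * (ℓ q - ℓ p) = 0 := by linarith
  rcases mul_eq_zero.1 this with h' | h'
  · have : b = 1 := by linarith
    subst this; simp
  · linarith

/-- upper end of an edge is a vertex -/
lemma vertex_of_edge (s : Finset V) (ℓ : V →L[ℝ] ℝ) (p q : V)
    (he : IsEdge (convexHull ℝ (s : Set V)) p q) (h : ℓ p < ℓ q) :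
    IsVertex (convexHull ℝ (s : Set V)) q := by
  obtain ⟨hpq, hne, hex⟩ := he
  obtain ⟨l, hl⟩ := hex hne
  have hq : q ∈ segment ℝ p q := right_mem_segment ℝ p q
  have hq' := hq
  rw [hl] at hq'
  have := face_of_face s l ℓ (l q) (ℓ q) {q} (by simp) (by simpa using hq'.1) (by simp)
    (fun x hx => hq'.2 x (subset_convexHull ℝ _ hx))
    (fun x hx hlx => by
      have hxs : x ∈ segment ℝ p q := by
        rw [hl]
        exact ⟨subset_convexHull ℝ _ hx, fun y hy => by rw [hlx]; exact hq'.2 y hy⟩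
      have := seg_aux hxs h
      refine ⟨this.2.1, fun e => ?_⟩
      rw [this.2.2 e]; simp)
  simpa [IsVertex] using this

lemma mid_mem (ℓ : V →L[ℝ] ℝ) (p q : V) (h : ℓ p < ℓ q) :
    midpoint ℝ p q ∈ intrinsicInterior ℝ (segment ℝ p q) := by
  have hm : midpoint ℝ p q ∈ segment ℝ p q := midpoint_mem_segment p q
  have hlm : ℓ (midpoint ℝ p q) = (ℓ p + ℓ q) / 2 := by
    rw [midpoint_eq_smul_add]; simp; ring
  rw [mem_intrinsicInterior]
  refine ⟨⟨midpoint ℝ p q, subset_affineSpan ℝ _ hm⟩, ?_, rfl⟩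
  rw [mem_interior]
  refine ⟨{y | ℓ p < ℓ y ∧ ℓ (y : V) < ℓ q}, ?_, ?_, ?_⟩
  · rintro ⟨y, hy⟩ ⟨h1, h2⟩
    simp only [mem_preimage] at h1 h2 ⊢
    rw [← convexHull_pair, affineSpan_convexHull] at hy
    obtain ⟨r, rfl⟩ := mem_affineSpan_pair_iff_exists_lineMap_eq.1 hy
    rw [AffineMap.lineMap_apply_module] at h1 h2 ⊢
    simp only [map_add, map_smul, smul_eq_mul] at h1 h2
    refine ⟨1 - r, r, ?_, ?_, by ring, rfl⟩
    · by_contra hc; push Not at hc; nlinarith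
    · by_contra hc; push Not at hc; nlinarith
  · have hc : Continuous fun y : affineSpan ℝ (segment ℝ p q) => ℓ (y : V) :=
      ℓ.continuous.comp continuous_subtype_val
    exact (isOpen_lt continuous_const hc).inter (isOpen_lt hc continuous_const)
  · simp only [mem_ofPred_eq, hlm]
    constructor <;> linarith

/-- a directed edge `p → q`: midpoint in `O⁻ q`. -/
lemma mid_oneg {P : Set V} {ℓ : V →L[ℝ] ℝ} {p q : V} (he : IsEdge P p q) (h : ℓ p < ℓ q) :
    midpoint ℝ p q ∈ Oneg P ℓ q := by
  simp only [Oneg, mem_iUnion]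
  refine ⟨segment ℝ p q, ⟨he.2, right_mem_segment ℝ p q, fun x hx => ?_⟩, mid_mem ℓ p q h⟩
  exact (seg_aux hx h).2.1

lemma ends_mem {P F : Set V} {p q : V} (he : IsEdge P p q)
    (hF : IsFace P F) (hm : midpoint ℝ p q ∈ F) : p ∈ F ∧ q ∈ F := by
  have hsub := he.2.2.subset
  have hp := hsub (left_mem_segment ℝ p q)
  have hq := hsub (right_mem_segment ℝ p q)
  obtain ⟨l, hl⟩ := hF.2 hF.1
  rw [hl] at hm ⊢
  have e : l (midpoint ℝ p q) = (l p + l q) / 2 := by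
    rw [midpoint_eq_smul_add]; simp; ring
  have h1 := hm.2 p hp
  have h2 := hm.2 q hq
  exact ⟨⟨hp, fun y hy => by have := hm.2 y hy; linarith⟩,
    ⟨hq, fun y hy => by have := hm.2 y hy; linarith⟩⟩

lemma fneg_le {P : Set V} {ℓ : V →L[ℝ] ℝ} {q : V} : ∀ y ∈ Fneg P ℓ q, ℓ y ≤ ℓ q := by
  have hc : IsClosed {y : V | ℓ y ≤ ℓ q} := isClosed_le ℓ.continuous continuous_const
  refine fun y hy => closure_minimal ?_ hc hy
  intro z hz
  simp only [Oneg, mem_iUnion] at hz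
  obtain ⟨G, ⟨_, hG⟩, hz⟩ := hz
  exact hG.2 z (intrinsicInterior_subset hz)

/-- Key consequence of stratification. -/
lemma strat_key (s : Finset V) (P : Set V) (hP : P = convexHull ℝ (s : Set V)) (ℓ : V →L[ℝ] ℝ)
    (hirr : ∀ u, IsVertex P u → IsFace P (Fneg P ℓ u) ∧ IsFace P (Fpos P ℓ u))
    (hstrat : StratNeg P ℓ) (v x q : V) (h1 : IsEdge P v x) (h1' : ℓ v < ℓ x)
    (h2 : IsEdge P x q) (h2' : ℓ x < ℓ q) :
    ∃ l : V →L[ℝ] ℝ, l x = l v ∧ l q = l v ∧ ∀ y ∈ P, l y = l v → ℓ y ≤ ℓ q := by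
  have vx : IsVertex P x := by subst hP; exact vertex_of_edge s ℓ v x h1 h1'
  have vq : IsVertex P q := by subst hP; exact vertex_of_edge s ℓ x q h2 h2'
  have hF := (hirr q vq).1
  have hxq := ends_mem h2 hF (subset_closure (mid_oneg h2 h2'))
  have hx : x ∈ Oneg P ℓ x := by
    simp only [Oneg, mem_iUnion]
    refine ⟨{x}, ⟨vx, by simp, by simp⟩, by simp⟩
  have hsub := hstrat x q vx vq ⟨x, hx, hxq.1⟩
  have hvx := ends_mem h1 hF (hsub (mid_oneg h1 h1'))
  have hle := fneg_le (P := P) (ℓ := ℓ) (q := q)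
  obtain ⟨l, hl⟩ := hF.2 hF.1
  rw [hl] at hxq hvx hle
  refine ⟨l, ?_, ?_, fun y hy he => hle y ⟨hy, fun z hz => by rw [he]; exact hvx.1.2 z hz⟩⟩
  · exact le_antisymm (hvx.1.2 _ hxq.1.1) (hxq.1.2 _ hvx.1.1)
  · exact le_antisymm (hvx.1.2 _ hxq.2.1) (hxq.2.2 _ hvx.1.1)

/-- Planar configuration: a face with coordinates `ℓ`, `κ`. -/
structure Planar (s S : Finset V) (ℓ κ ψ : V →L[ℝ] ℝ) (M : ℝ) (v w d t : V) : Prop where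
  le : ∀ x ∈ s, ψ x ≤ M
  mem : ∀ x, x ∈ S ↔ x ∈ s ∧ ψ x = M
  vS : v ∈ S
  wS : w ∈ S
  coord : ∀ y ∈ S, y = v + (ℓ y - ℓ v) • d + (κ y - κ v) • t
  nonneg : ∀ y ∈ S, κ v ≤ κ y
  kw : κ w = κ v
  lv : ∀ y ∈ S, ℓ v ≤ ℓ y
  lw : ∀ y ∈ S, ℓ y ≤ ℓ w
  lt : ℓ v < ℓ w

lemma Planar.face {s S : Finset V} {ℓ κ ψ : V →L[ℝ] ℝ} {M : ℝ} {v w d t : V}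
    (H : Planar s S ℓ κ ψ M v w d t) (χ : V →L[ℝ] ℝ) (M' : ℝ) (A : Set V)
    (hA : A.Nonempty) (hAS : A ⊆ S) (hA1 : ∀ x ∈ A, χ x = M')
    (h2 : ∀ x ∈ S, χ x ≤ M' ∧ (χ x = M' → x ∈ convexHull ℝ A)) :
    IsFace (convexHull ℝ (s : Set V)) (convexHull ℝ A) :=
  face_of_face s ψ χ M M' A hA
    (fun x hx => subset_convexHull ℝ _ ((H.mem x).1 (hAS hx)).1)
    (fun x hx => ⟨((H.mem x).1 (hAS hx)).2, hA1 x hx⟩) H.le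
    (fun x hx hp => h2 x ((H.mem x).2 ⟨hx, hp⟩))

lemma Planar.ext' {s S : Finset V} {ℓ κ ψ : V →L[ℝ] ℝ} {M : ℝ} {v w d t : V}
    (H : Planar s S ℓ κ ψ M v w d t) {y z : V} (hy : y ∈ S) (hz : z ∈ S)
    (h1 : ℓ y = ℓ z) (h2 : κ y = κ z) : y = z := by
  rw [H.coord y hy, H.coord z hz, h1, h2]

lemma Planar.end_unique {s S : Finset V} {ℓ κ ψ : V →L[ℝ] ℝ} {M : ℝ} {v w d t : V}
    (H : Planar s S ℓ κ ψ M v w d t) (hℓ : NonconstOnEdges (convexHull ℝ (s : Set V)) ℓ)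
    (e : V) (he : e ∈ S) (hk : κ e = κ v) (σ : ℝ) (hσ : σ ≠ 0)
    (hm : ∀ z ∈ S, σ * ℓ z ≤ σ * ℓ e) (y : V) (hy : y ∈ S) (hye : ℓ y = ℓ e) : y = e := by
  classical
  obtain ⟨q, hq, hqm⟩ := (S.filter fun z => ℓ z = ℓ e).exists_max_image (fun z => κ z)
    ⟨e, by simp [he]⟩
  rw [Finset.mem_filter] at hq
  by_cases h : κ q = κ v
  · refine H.ext' hy he hye ?_
    have h1 := hqm y (by simp [hy, hye])
    have h2 := H.nonneg y hy
    linarith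
  exfalso
  have hlt : κ v < κ q := lt_of_le_of_ne (H.nonneg q hq.1) (Ne.symm h)
  refine hℓ e q ⟨fun h' => h (by rw [← h', hk]), ?_⟩ hq.2.symm
  rw [← convexHull_pair]
  refine H.face (σ • ℓ) (σ * ℓ e) _ (by simp) ?_ ?_ ?_
  · rintro x (rfl | rfl)
    · exact he
    · exact hq.1
  · rintro x (rfl | rfl)
    · simp
    · simp [hq.2]
  · intro x hx
    refine ⟨by simpa using hm x hx, fun hx' => ?_⟩
    have hx' : ℓ x = ℓ e := mul_left_cancel₀ hσ (by simpa using hx')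
    have hk1 := hqm x (by simp [hx, hx'])
    have hk2 := H.nonneg x hx
    refine mem_conv_pair _ _ _ ((κ x - κ v) / (κ q - κ v)) (div_nonneg (by linarith) (by linarith))
      ((div_le_one (by linarith)).2 (by linarith)) ?_
    have cx := H.coord x hx
    have cq := H.coord q hq.1
    have ce := H.coord e he
    rw [hx'] at cx
    rw [hq.2] at cq
    have hqe : q - e = (κ q - κ v) • t := by
      rw [hk] at ce
      linear_combination (norm := module) cq - ce
    rw [hqe, smul_smul, div_mul_cancel₀ _ (by linarith)]
    rw [hk] at ce
    linear_combination (norm := module) cx - ce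

lemma slope_lemma (S : Finset V) (ℓ κ : V →L[ℝ] ℝ) (x : V) (hex : ∃ z ∈ S, ℓ x < ℓ z) :
    ∃ q ∈ S, ∃ m : ℝ, ℓ x < ℓ q ∧ κ q - κ x = m * (ℓ q - ℓ x) ∧
      ∀ z ∈ S, ℓ x < ℓ z → κ z - κ x ≤ m * (ℓ z - ℓ x) ∧
        (κ z - κ x = m * (ℓ z - ℓ x) → ℓ z ≤ ℓ q) := by
  classical
  obtain ⟨z0, hz0, hz0'⟩ := hex
  obtain ⟨r, hr, hrm⟩ := (S.filter fun z => ℓ x < ℓ z).exists_max_image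
    (fun z => (κ z - κ x) / (ℓ z - ℓ x)) ⟨z0, by simp [hz0, hz0']⟩
  rw [Finset.mem_filter] at hr
  set m := (κ r - κ x) / (ℓ r - ℓ x) with hm
  have hrr : κ r - κ x = m * (ℓ r - ℓ x) := by
    rw [hm, div_mul_cancel₀]; linarith [hr.2]
  obtain ⟨q, hq, hqm⟩ := (S.filter fun z => ℓ x < ℓ z ∧ κ z - κ x = m * (ℓ z - ℓ x)).exists_max_image
    (fun z => ℓ z) ⟨r, by simp [hr, hrr]⟩
  rw [Finset.mem_filter] at hq
  refine ⟨q, hq.1, m, hq.2.1, hq.2.2, fun z hz hz' => ⟨?_, fun h => hqm z ?_⟩⟩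
  · have := hrm z (by simp [hz, hz'])
    rwa [div_le_iff₀ (by linarith)] at this
  · simp [hz, hz', h]

lemma Planar.edge {s S : Finset V} {ℓ κ ψ : V →L[ℝ] ℝ} {M : ℝ} {v w d t : V}
    (H : Planar s S ℓ κ ψ M v w d t) (x q : V) (hx : x ∈ S) (hq : q ∈ S) (m : ℝ)
    (hlt : ℓ x < ℓ q) (hs : κ q - κ x = m * (ℓ q - ℓ x))
    (h1 : ∀ z ∈ S, ℓ x < ℓ z → κ z - κ x ≤ m * (ℓ z - ℓ x) ∧
        (κ z - κ x = m * (ℓ z - ℓ x) → ℓ z ≤ ℓ q))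
    (h2 : ∀ z ∈ S, ℓ z ≤ ℓ x → κ z - κ x ≤ m * (ℓ z - ℓ x) ∧
        (κ z - κ x = m * (ℓ z - ℓ x) → z = x)) :
    IsEdge (convexHull ℝ (s : Set V)) x q := by
  refine ⟨fun h => by rw [h] at hlt; exact lt_irrefl _ hlt, ?_⟩
  rw [← convexHull_pair]
  refine H.face (κ - m • ℓ) (κ x - m * ℓ x) _ (by simp) ?_ ?_ ?_
  · rintro y (rfl | rfl)
    · exact hx
    · exact hq
  · rintro y (rfl | rfl)
    · simp
    · simp; linarith
  · intro z hz
    simp only [sub_apply, smul_apply, smul_eq_mul]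
    rcases le_or_gt (ℓ z) (ℓ x) with h | h
    · obtain ⟨a, b⟩ := h2 z hz h
      refine ⟨by linarith, fun e => ?_⟩
      rw [b (by linarith)]
      exact subset_convexHull ℝ _ (by simp)
    · obtain ⟨a, b⟩ := h1 z hz h
      refine ⟨by linarith, fun e => ?_⟩
      have e' : κ z - κ x = m * (ℓ z - ℓ x) := by linarith
      have b := b e'
      have hpos : 0 < ℓ q - ℓ x := by linarith
      refine mem_conv_pair _ _ _ ((ℓ z - ℓ x) / (ℓ q - ℓ x)) (div_nonneg (by linarith) hpos.le)
        ((div_le_one hpos).2 (by linarith)) ?_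
      have e1 : ∀ y ∈ S, κ y - κ x = m * (ℓ y - ℓ x) → y - x = (ℓ y - ℓ x) • (d + m • t) := by
        intro y hy hk
        have cy := H.coord y hy
        have cx := H.coord x hx
        have : κ y - κ v = (κ x - κ v) + m * (ℓ y - ℓ x) := by linarith
        rw [this] at cy
        linear_combination (norm := module) cy - cx
      rw [e1 q hq hs, smul_smul, div_mul_cancel₀ _ hpos.ne', ← e1 z hz e']
      abel

lemma Planar.triangle {s S : Finset V} {ℓ κ ψ : V →L[ℝ] ℝ} {M : ℝ} {v w d t : V}
    (H : Planar s S ℓ κ ψ M v w d t) (P : Set V) (hP : P = convexHull ℝ (s : Set V))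
    (hℓ : NonconstOnEdges P ℓ)
    (hirr : ∀ u, IsVertex P u → IsFace P (Fneg P ℓ u) ∧ IsFace P (Fpos P ℓ u))
    (hstrat : StratNeg P ℓ) (hex : ∃ y ∈ S, κ v < κ y) :
    ∃ x ∈ S, κ v < κ x ∧ IsFace P (convexHull ℝ ({v, w, x} : Set V)) := by
  have uv : ∀ y ∈ S, ℓ y = ℓ v → y = v := fun y hy hy' =>
    H.end_unique (hP ▸ hℓ) v H.vS rfl (-1) (by norm_num)
      (fun z hz => by linarith [H.lv z hz]) y hy hy'
  have uw : ∀ y ∈ S, ℓ y = ℓ w → y = w := fun y hy hy' =>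
    H.end_unique (hP ▸ hℓ) w H.wS H.kw 1 (by norm_num)
      (fun z hz => by linarith [H.lw z hz]) y hy hy'
  obtain ⟨x, hx, m, hvx, hmx, hm⟩ := slope_lemma S ℓ κ v ⟨w, H.wS, H.lt⟩
  -- all points lie below the first line
  have hle : ∀ z ∈ S, κ z - κ v ≤ m * (ℓ z - ℓ v) := by
    intro z hz
    rcases (H.lv z hz).eq_or_lt with h | h
    · rw [uv z hz h.symm]; simp
    · exact (hm z hz h).1
  have hmpos : 0 < m := by
    obtain ⟨y, hy, hy'⟩ := hex
    have h1 := hle y hy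
    have h2 := H.lv y hy
    by_contra hc
    push Not at hc
    nlinarith
  have hkx : κ v < κ x := by
    have : 0 < m * (ℓ x - ℓ v) := mul_pos hmpos (by linarith)
    linarith
  have hxw : ℓ x < ℓ w := by
    refine lt_of_le_of_ne (H.lw x hx) fun h => ?_
    have := H.kw
    rw [uw x hx h] at hkx
    linarith
  have e1 : IsEdge P v x := by
    rw [hP]
    refine H.edge v x H.vS hx m hvx hmx hm fun z hz hz' => ?_
    have := uv z hz (le_antisymm hz' (H.lv z hz))
    subst this
    simp
  obtain ⟨q, hq, m2, hxq, hmq, hm2⟩ := slope_lemma S ℓ κ x ⟨w, H.wS, hxw⟩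
  have hqs : κ q - κ v < m * (ℓ q - ℓ v) := by
    refine lt_of_le_of_ne (hle q hq) fun h => ?_
    have := (hm q hq (by linarith)).2 h
    linarith
  have hmm : m2 < m := by
    by_contra hc
    push Not at hc
    have : 0 < ℓ q - ℓ x := by linarith
    nlinarith
  have hle2 : ∀ z ∈ S, ℓ z ≤ ℓ x → κ z - κ x ≤ m2 * (ℓ z - ℓ x) ∧
        (κ z - κ x = m2 * (ℓ z - ℓ x) → z = x) := by
    intro z hz hzx
    have h1 := hle z hz
    have h2 : 0 ≤ (m - m2) * (ℓ x - ℓ z) := mul_nonneg (by linarith) (by linarith)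
    refine ⟨by linarith, fun he => ?_⟩
    have h3 : (m - m2) * (ℓ x - ℓ z) = 0 := by linarith
    have h4 : ℓ x = ℓ z := by
      rcases mul_eq_zero.1 h3 with h | h <;> linarith
    refine H.ext' hz hx h4.symm ?_
    rw [h4] at he; linarith
  have e2 : IsEdge P x q := by
    rw [hP]
    exact H.edge x q hx hq m2 hxq hmq hm2 hle2
  obtain ⟨l, lx, lq, hl⟩ := strat_key s P hP ℓ hirr hstrat v x q e1 hvx e2 hxq
  have cl : ∀ y ∈ S, l y - l v = (ℓ y - ℓ v) * l d + (κ y - κ v) * l t := by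
    intro y hy
    have := congrArg l (H.coord y hy)
    simp only [map_add, map_smul, smul_eq_mul] at this
    linarith
  have c1 := cl x hx
  have c2 := cl q hq
  have c3 := cl w H.wS
  rw [lx, hmx] at c1
  rw [lq] at c2
  have hd1 : l d + m * l t = 0 := by
    have : (ℓ x - ℓ v) * (l d + m * l t) = 0 := by linarith
    rcases mul_eq_zero.1 this with h | h
    · linarith
    · exact h
  have ht : l t = 0 := by
    have : (κ q - κ v - m * (ℓ q - ℓ v)) * l t = 0 := by
      linear_combination -c2 - (ℓ q - ℓ v) * hd1
    rcases mul_eq_zero.1 this with h | h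
    · linarith
    · exact h
  have hd0 : l d = 0 := by rw [ht] at hd1; linarith
  have hlw : l w = l v := by rw [hd0, ht] at c3; linarith
  have hwq := hl w (by rw [hP]; exact subset_convexHull ℝ _ ((H.mem w).1 H.wS).1) hlw
  have hqw : q = w := uw q hq (le_antisymm (H.lw q hq) hwq)
  subst hqw
  refine ⟨x, hx, hkx, ?_⟩
  have hle3 : ∀ z ∈ S, κ z - κ x ≤ m2 * (ℓ z - ℓ x) := fun z hz => by
    rcases le_or_gt (ℓ z) (ℓ x) with h | h
    · exact (hle2 z hz h).1
    · exact (hm2 z hz h).1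
  rw [hP]
  refine H.face 0 0 _ (by simp) ?_ (by simp) fun z hz => ⟨by simp, fun _ => ?_⟩
  · rintro y (rfl | rfl | rfl)
    · exact H.vS
    · exact hq
    · exact hx
  -- z = (1 - b - c) v + b q + c x
  have hz0 := H.nonneg z hz
  have hz1 := hle z hz
  have hz2 := hle3 z hz
  set K := κ x - κ v with hK
  set L := ℓ q - ℓ v with hL
  have hKpos : 0 < K := by linarith
  have hLpos : 0 < L := by linarith [H.lt]
  set c := (κ z - κ v) / K with hc
  have hcK : c * K = κ z - κ v := div_mul_cancel₀ _ hKpos.ne'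
  set b := (ℓ z - ℓ v - c * (ℓ x - ℓ v)) / L with hb
  have hbL : b * L = ℓ z - ℓ v - c * (ℓ x - ℓ v) := div_mul_cancel₀ _ hLpos.ne'
  have c0 : 0 ≤ c := div_nonneg (by linarith) hKpos.le
  have b0 : 0 ≤ b := by
    refine div_nonneg ?_ hLpos.le
    have : 0 ≤ m * (ℓ z - ℓ v - c * (ℓ x - ℓ v)) := by
      have : m * (c * (ℓ x - ℓ v)) = c * K := by rw [hmx]; ring
      rw [mul_sub, this, hcK]; linarith
    exact nonneg_of_mul_nonneg_right this hmpos
  have hbc : b + c ≤ 1 := by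
    -- second line, which passes through q
    have hkq : κ q = κ v := H.kw
    have hm2neg : m2 < 0 := by
      by_contra hcon
      push Not at hcon
      have : 0 ≤ m2 * (ℓ q - ℓ x) := mul_nonneg hcon (by linarith)
      linarith
    have h1 : κ z - κ v ≤ m2 * (ℓ z - ℓ q) := by linarith
    have h2 : c * K = c * (m2 * (ℓ x - ℓ q)) := by
      congr 1; linarith
    have h3 : 0 ≤ m2 * ((b + c - 1) * L) := by
      have : (b + c - 1) * L = (ℓ z - ℓ v - c * (ℓ x - ℓ v)) + c * L - L := by
        rw [← hbL]; ring
      rw [this]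
      have : m2 * ((ℓ z - ℓ v - c * (ℓ x - ℓ v)) + c * L - L)
          = m2 * (ℓ z - ℓ q) - c * (m2 * (ℓ x - ℓ q)) := by rw [hL]; ring
      rw [this, ← h2, hcK]; linarith
    by_contra hcon
    push Not at hcon
    have : 0 < (b + c - 1) * L := mul_pos (by linarith) hLpos
    nlinarith
  have hcz := H.coord z hz
  have hcq := H.coord q hq
  have hcx := H.coord x hx
  have hfin : z = (1 - b - c) • v + b • q + c • x := by
    have hkq : κ q - κ v = 0 := by linarith [H.kw]
    rw [hkq, ← hL] at hcq
    rw [← hK] at hcx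
    have hlz : ℓ z - ℓ v = b * L + c * (ℓ x - ℓ v) := by linarith
    rw [← hcK, hlz] at hcz
    linear_combination (norm := module) hcz - b • hcq - c • hcx
  rw [hfin]
  have hcv := convex_convexHull ℝ ({v, q, x} : Set V)
  have := hcv.sum_mem (t := Finset.univ) (w := ![1 - b - c, b, c]) (z := ![v, q, x])
    (by intro i _; fin_cases i <;> simp <;> linarith)
    (by simp [Fin.sum_univ_three]; ring)
    (by intro i _; fin_cases i <;> exact subset_convexHull ℝ _ (by simp))
  simpa [Fin.sum_univ_three] using this

lemma exists_min_gen (U : Finset V) : ∃ T : Finset V, T ⊆ U ∧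
    (∀ u ∈ U, u ∈ convexHull ℝ (T : Set V)) ∧
    ∀ t ∈ T, ∃ f : V →L[ℝ] ℝ, ∀ u ∈ U, f u ≤ f t ∧ (f u = f t → u = t) := by
  classical
  let C : Finset (Finset V) := U.powerset.filter fun T : Finset V => ∀ u ∈ U, u ∈ convexHull ℝ (T : Set V)
  obtain ⟨T, hT, hmin⟩ := C.exists_min_image (fun T => T.card)
    ⟨U, by simp only [C, Finset.mem_filter, Finset.mem_powerset]
           exact ⟨subset_rfl, fun u hu => subset_convexHull ℝ _ hu⟩⟩
  simp only [C, Finset.mem_filter, Finset.mem_powerset] at hT hmin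
  refine ⟨T, hT.1, hT.2, fun t ht => ?_⟩
  have hnt : t ∉ convexHull ℝ ((T.erase t : Finset V) : Set V) := by
    intro hc
    have := hmin (T.erase t) ⟨(Finset.erase_subset _ _).trans hT.1, fun u hu => by
      refine convexHull_min ?_ (convex_convexHull ℝ _) (hT.2 u hu)
      intro x hx
      by_cases hxt : x = t
      · rw [hxt]; exact hc
      · exact subset_convexHull ℝ _ (by simpa [hxt] using hx)⟩
    have := Finset.card_erase_lt_of_mem ht
    omega
  obtain ⟨f, u0, h1, h2⟩ := geometric_hahn_banach_closed_point (convex_convexHull ℝ _)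
    ((T.erase t).finite_toSet.isClosed_convexHull ℝ) hnt
  refine ⟨f, fun u hu => ?_⟩
  have := conv_max (T : Set V) {t} (convex_singleton t) f (f t) (by
    intro x hx
    by_cases hxt : x = t
    · simp [hxt]
    · have := h1 x (subset_convexHull ℝ _ (by simpa [hxt] using hx))
      exact ⟨by linarith, fun h => by linarith⟩) u (hT.2 u hu)
  simpa using this

lemma vectorSpan_tri (v w x : V) :
    vectorSpan ℝ (convexHull ℝ ({v, w, x} : Set V)) = Submodule.span ℝ {w - v, x - v} := by
  rw [← direction_affineSpan, affineSpan_convexHull, direction_affineSpan,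
    vectorSpan_eq_span_vsub_set_right ℝ (p := v) (by simp)]
  simp only [vsub_eq_sub, image_insert_eq, image_singleton, sub_self, Submodule.span_insert_zero]

/-- the third vertex of a triangular face is a generator -/
lemma tri_mem (s : Finset V) (v w x : V)
    (hF : IsFace (convexHull ℝ (s : Set V)) (convexHull ℝ ({v, w, x} : Set V)))
    (hd : dimS (convexHull ℝ ({v, w, x} : Set V)) = 2) : x ∈ s := by
  classical
  have hx : x - v ∉ Submodule.span ℝ ({w - v} : Set V) := by
    intro hc
    rw [dimS, vectorSpan_tri] at hd
    have h1 : Submodule.span ℝ {w - v, x - v} = Submodule.span ℝ ({w - v} : Set V) := by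
      rw [Set.pair_comm, Submodule.span_insert_eq_span hc]
    rw [h1] at hd
    have := finrank_span_le_card (R := ℝ) ({w - v} : Set V)
    simp only [Set.toFinset_singleton, Finset.card_singleton] at this
    omega
  obtain ⟨f, u0, h1, h2⟩ := geometric_hahn_banach_closed_point
    (Submodule.span ℝ ({w - v} : Set V)).convex
    (Submodule.closed_of_finiteDimensional _) hx
  have hw : f (w - v) = 0 := by
    by_contra hne
    have := h1 (((u0 + 1) / f (w - v)) • (w - v))
      (Submodule.smul_mem _ _ (Submodule.mem_span_singleton_self _))
    rw [map_smul, smul_eq_mul, div_mul_cancel₀ _ hne] at this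
    linarith
  have h0 := h1 0 (Submodule.zero_mem _)
  simp only [map_sub, map_zero] at hw h0 h2
  have hface := face_of_face ({v, w, x} : Finset V) 0 f 0 (f x) {x} (by simp)
    (by simpa using subset_convexHull ℝ ({v, w, x} : Set V) (by simp)) (by simp) (by simp)
    (by
      intro y hy _
      simp only [Finset.mem_insert, Finset.mem_singleton] at hy
      rcases hy with rfl | rfl | rfl
      · exact ⟨by linarith, fun h => by linarith⟩
      · exact ⟨by linarith, fun h => by linarith⟩
      · simp)
  simp only [Finset.coe_insert, Finset.coe_singleton, convexHull_singleton] at hface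
  have := (hF.2.isExtreme.trans hface.2.isExtreme).mem_extremePoints
  exact_mod_cast extremePoints_convexHull_subset this

lemma main_aux (s : Finset V) (P : Set V) (hP : P = convexHull ℝ (s : Set V)) (ℓ : V →L[ℝ] ℝ)
    (hℓ : NonconstOnEdges P ℓ)
    (hirr : ∀ u, IsVertex P u → IsFace P (Fneg P ℓ u) ∧ IsFace P (Fpos P ℓ u))
    (hstrat : StratNeg P ℓ)
    (v w : V) (hv : MinAt ℓ P v) (hw : MaxAt ℓ P w) (hvw : DirEdge P ℓ v w)
    (vs : v ∈ s) (ws : w ∈ s) :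
    dimS P - 1 ≤
      {x : V | IsFace P (convexHull ℝ ({v, w, x} : Set V)) ∧
        dimS (convexHull ℝ ({v, w, x} : Set V)) = 2}.ncard := by
  classical
  obtain ⟨⟨hne, hfne, hfex⟩, hlt⟩ := hvw
  obtain ⟨φ, hφ⟩ := hfex hfne
  have sP : ∀ x ∈ s, x ∈ P := fun x hx => by rw [hP]; exact subset_convexHull ℝ _ hx
  have ha : 0 < ℓ w - ℓ v := by linarith
  set a := ℓ w - ℓ v with hadef
  set d := a⁻¹ • (w - v) with hd
  have hld : ℓ d = 1 := by
    rw [hd, map_smul, map_sub, smul_eq_mul, ← hadef, inv_mul_cancel₀ ha.ne']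
  have hdw : a • d = w - v := by rw [hd, smul_smul, mul_inv_cancel₀ ha.ne', one_smul]
  set κ : V →L[ℝ] ℝ := -φ with hκ
  have hvφ : v ∈ {x ∈ P | ∀ y ∈ P, φ y ≤ φ x} := hφ ▸ left_mem_segment ℝ v w
  have hwφ : w ∈ {x ∈ P | ∀ y ∈ P, φ y ≤ φ x} := hφ ▸ right_mem_segment ℝ v w
  have hκP : ∀ y ∈ P, κ v ≤ κ y := fun y hy => by
    have := hvφ.2 y hy
    simp only [hκ, neg_apply]; linarith
  have hκw : κ w = κ v := by
    have h1 := hκP w hwφ.1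
    have h2 := hwφ.2 v hvφ.1
    simp only [hκ, neg_apply] at h1 ⊢; linarith
  have hκd : κ d = 0 := by rw [hd, map_smul, map_sub, hκw]; simp
  have hseg : ∀ y ∈ P, κ y = κ v → y - v = (ℓ y - ℓ v) • d := by
    intro y hy he
    have : y ∈ segment ℝ v w := by
      rw [hφ]
      refine ⟨hy, fun z hz => ?_⟩
      have h1 := hvφ.2 z hz
      simp only [hκ, neg_apply] at he
      linarith
    obtain ⟨b, c, hb, hc, hbc, rfl⟩ := this
    have hb' : b = 1 - c := by linarith
    subst hb'
    have : ℓ ((1 - c) • v + c • w) - ℓ v = c * a := by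
      simp only [map_add, map_smul, smul_eq_mul, hadef]; ring
    rw [this, mul_smul, hdw]; module
  let π : V →L[ℝ] V := ContinuousLinearMap.id ℝ V - ℓ.smulRight d
  have hπ : ∀ y, π y = y - ℓ y • d := fun y => by simp [π]
  let p : V → V := fun x => (κ x - κ v)⁻¹ • π (x - v)
  have hp : ∀ x, κ v < κ x → x - v = (ℓ x - ℓ v) • d + (κ x - κ v) • p x := by
    intro x hx
    have : (κ x - κ v) • p x = π (x - v) := by
      simp only [p]
      rw [smul_smul, mul_inv_cancel₀ (by linarith), one_smul]
    rw [this, hπ, map_sub]; module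
  obtain ⟨T, hTU, hUT, hsep⟩ := exists_min_gen ((s.filter fun x => κ v < κ x).image p)
  -- each generator gives a triangle
  have hmain : ∀ t ∈ T, ∃ x, κ v < κ x ∧ p x = t ∧
      IsFace P (convexHull ℝ ({v, w, x} : Set V)) := by
    intro t ht
    obtain ⟨f, hf⟩ := hsep t ht
    let ψ : V →L[ℝ] ℝ := f.comp π - f t • κ
    have hψ : ∀ y, ψ y = f (π y) - f t * κ y := fun y => by simp [ψ]
    have hψ0 : ∀ y ∈ P, κ y = κ v → ψ y = ψ v := by
      intro y hy he
      have h1 := hseg y hy he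
      have h2 : π (y - v) = 0 := by
        rw [hπ, map_sub]; rw [← h1]; simp
      rw [hψ, hψ, he]
      have h3 : f (π y) - f (π v) = 0 := by
        rw [← map_sub, ← map_sub, h2, map_zero]
      linarith
    have hψ1 : ∀ x, κ v < κ x → ψ x - ψ v = (κ x - κ v) * (f (p x) - f t) := by
      intro x hx
      have h1 : π (x - v) = (κ x - κ v) • p x := by
        simp only [p]
        rw [smul_smul, mul_inv_cancel₀ (by linarith), one_smul]
      have h3 : f (π x) - f (π v) = (κ x - κ v) * f (p x) := by
        rw [← map_sub, ← map_sub, h1, map_smul, smul_eq_mul]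
      rw [hψ, hψ]
      linear_combination h3
    have hU : ∀ x ∈ s, κ v < κ x → p x ∈ (s.filter fun x => κ v < κ x).image p :=
      fun x hx h => Finset.mem_image_of_mem _ (by simp [hx, h])
    have hS : ∀ x ∈ s, ψ x = ψ v → κ v < κ x → p x = t := by
      intro x hx he hk
      have h1 := hψ1 x hk
      rw [he, sub_self] at h1
      have h2 : f (p x) - f t = 0 := by
        rcases mul_eq_zero.1 h1.symm with h | h
        · linarith
        · exact h
      exact (hf _ (hU x hx hk)).2 (by linarith)
    have H : Planar s (s.filter fun x => ψ x = ψ v) ℓ κ ψ (ψ v) v w d t :=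
      { le := by
          intro x hx
          rcases (hκP x (sP x hx)).eq_or_lt with h | h
          · rw [hψ0 x (sP x hx) h.symm]
          · have h1 := hψ1 x h
            have h2 := (hf _ (hU x hx h)).1
            nlinarith
        mem := by simp
        vS := by simp [vs]
        wS := by simp [ws, hψ0 w (sP w ws) hκw]
        coord := by
          intro y hy
          rw [Finset.mem_filter] at hy
          rcases (hκP y (sP y hy.1)).eq_or_lt with h | h
          · have := hseg y (sP y hy.1) h.symm
            rw [← h, sub_self, zero_smul, add_zero, ← this]; abel
          · have := hp y h
            rw [hS y hy.1 hy.2 h] at this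
            rw [add_assoc, ← this]; abel
        nonneg := fun y hy => hκP y (sP y (Finset.mem_filter.1 hy).1)
        kw := hκw
        lv := fun y hy => hv.2 y (sP y (Finset.mem_filter.1 hy).1)
        lw := fun y hy => hw.2 y (sP y (Finset.mem_filter.1 hy).1)
        lt := hlt }
    obtain ⟨x0, hx0, hx0t⟩ := Finset.mem_image.1 (hTU ht)
    rw [Finset.mem_filter] at hx0
    have hx0' : ψ x0 = ψ v := by
      have := hψ1 x0 hx0.2
      rw [hx0t, sub_self, mul_zero] at this
      linarith
    obtain ⟨x, hxS, hxk, hxF⟩ := H.triangle P hP hℓ hirr hstrat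
      ⟨x0, by simp [hx0, hx0'], hx0.2⟩
    rw [Finset.mem_filter] at hxS
    exact ⟨x, hxk, hS x hxS.1 hxS.2 hxk, hxF⟩
  choose! X hX1 hX2 hX3 using hmain
  have hdim : ∀ x, κ v < κ x → dimS (convexHull ℝ ({v, w, x} : Set V)) = 2 := by
    intro x hx
    rw [dimS, vectorSpan_tri]
    have hli : LinearIndependent ℝ ![w - v, x - v] := by
      rw [LinearIndependent.pair_iff]
      intro b c h
      have h1 := congrArg κ h
      simp only [map_add, map_smul, map_sub, hκw, sub_self, smul_eq_mul, mul_zero, zero_add,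
        map_zero] at h1
      have hc : c = 0 := by
        rcases mul_eq_zero.1 h1 with h | h
        · exact h
        · linarith
      subst hc
      have h2 := congrArg ℓ h
      simp only [map_add, map_smul, map_sub, smul_eq_mul, zero_mul, add_zero, map_zero] at h2
      refine ⟨?_, rfl⟩
      rcases mul_eq_zero.1 h2 with h | h
      · exact h
      · linarith
    have := finrank_span_eq_card hli
    rwa [Matrix.range_cons_cons_empty, Fintype.card_fin] at this
  have hfin : {x : V | IsFace P (convexHull ℝ ({v, w, x} : Set V)) ∧
        dimS (convexHull ℝ ({v, w, x} : Set V)) = 2}.Finite :=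
    s.finite_toSet.subset fun x hx => tri_mem s v w x (hP ▸ hx.1) hx.2
  have hcard : T.card ≤ {x : V | IsFace P (convexHull ℝ ({v, w, x} : Set V)) ∧
        dimS (convexHull ℝ ({v, w, x} : Set V)) = 2}.ncard := by
    rw [← Set.ncard_coe_finset]
    refine Set.ncard_le_ncard_of_injOn X (fun t ht => ⟨hX3 t ht, hdim _ (hX1 t ht)⟩) ?_ hfin
    intro t ht t' ht' h
    rw [← hX2 t ht, ← hX2 t' ht', h]
  have hdimP : dimS P ≤ T.card + 1 := by
    have hsub : vectorSpan ℝ P ≤ Submodule.span ℝ ((insert d T : Finset V) : Set V) := by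
      rw [hP, ← direction_affineSpan, affineSpan_convexHull, direction_affineSpan,
        vectorSpan_eq_span_vsub_set_right ℝ (p := v) (by exact_mod_cast vs), Submodule.span_le]
      rintro _ ⟨x, hx, rfl⟩
      have hx : x ∈ s := by exact_mod_cast hx
      simp only [vsub_eq_sub, SetLike.mem_coe]
      have hdm : d ∈ Submodule.span ℝ ((insert d T : Finset V) : Set V) :=
        Submodule.subset_span (by simp)
      rcases (hκP x (sP x hx)).eq_or_lt with h | h
      · rw [hseg x (sP x hx) h.symm]
        exact Submodule.smul_mem _ _ hdm
      · rw [hp x h]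
        refine Submodule.add_mem _ (Submodule.smul_mem _ _ hdm) (Submodule.smul_mem _ _ ?_)
        have h1 := hUT (p x) (Finset.mem_image_of_mem _ (by simp [hx, h]))
        refine convexHull_min ?_ (Submodule.convex _) h1
        intro y hy
        exact Submodule.subset_span (by simp at hy ⊢; exact Or.inr hy)
    calc dimS P ≤ Module.finrank ℝ (Submodule.span ℝ ((insert d T : Finset V) : Set V)) :=
          Submodule.finrank_mono hsub
      _ ≤ (insert d T).card := finrank_span_finset_le_card _
      _ ≤ T.card + 1 := Finset.card_insert_le _ _
  omega

/-- Under the Stratification Assumption, if the source `v` and sink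
`w` of `P` are joined by a directed edge, then the number of triangular 2-faces of
`P` of the form `(v, w, x)` is at least `dim P − 1`. -/
theorem stmt19 (P : Set V) (hP : IsPolytope P) (ℓ : V →L[ℝ] ℝ)
    (hℓ : NonconstOnEdges P ℓ)
    (hirr : ∀ u, IsVertex P u → IsFace P (Fneg P ℓ u) ∧ IsFace P (Fpos P ℓ u))
    (hstrat : StratNeg P ℓ)
    (v w : V) (hv : MinAt ℓ P v) (hw : MaxAt ℓ P w) (hvw : DirEdge P ℓ v w) :
    dimS P - 1 ≤
      {x : V | IsFace P (convexHull ℝ ({v, w, x} : Set V)) ∧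
        dimS (convexHull ℝ ({v, w, x} : Set V)) = 2}.ncard := by
  classical
  obtain ⟨s, _, hs⟩ := hP
  refine main_aux (insert v (insert w s)) P ?_ ℓ hℓ hirr hstrat v w hv hw hvw (by simp) (by simp)
  apply subset_antisymm
  · rw [hs]
    exact convexHull_mono (by intro x hx; simp only [Finset.coe_insert]; exact Or.inr (Or.inr hx))
  · refine convexHull_min ?_ (by rw [hs]; exact convex_convexHull ℝ _)
    intro x hx
    simp only [Finset.coe_insert] at hx
    rcases hx with rfl | rfl | hx
    · exact hv.1
    · exact hw.1
    · rw [hs]; exact subset_convexHull ℝ _ hx
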